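/- Let L ⊆ V^P be an isotropic subspace that does not split off any zero factor nor a Bell Lagrangian as a direct factor. Then for each p ∈ P at least one of the following holds: (1) A(L)_p is contained in the octahedral group, or (2) A(L)_p is contained in one of the infinite dihedral groups D_x, D_y, D_z. -/

import Mathlib

/- Common framework: binary stabilizer codes, local unitary/SO(3) automorphism groups. -/

noncomputable section
open scoped Matrix Real ComplexConjugate
open scoped Classical

namespace Stab

/-- The one-qubit phase space `V = 𝔽₂ ⊕ 𝔽₂`, with first coordinate the `z`-component
and second coordinate the `x`-component. -/
abbrev V : Type := ZMod 2 × ZMod 2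

/-- The symplectic form on `V`. -/
def omegaV (u v : V) : ZMod 2 := u.1 * v.2 + u.2 * v.1

/-- The phase space `V^P` over a set of qubits `P`. -/
abbrev QV (P : Type) := P → V

variable {P : Type} [Fintype P] [DecidableEq P]

/-- The direct-sum symplectic form on `V^P`. -/
def omega (u v : QV P) : ZMod 2 := ∑ p, omegaV (u p) (v p)

/-- A subspace `L ⊆ V^P` is isotropic if `ω` vanishes identically on `L × L`. -/
def Isotropic (L : Submodule (ZMod 2) (QV P)) : Prop := ∀ u ∈ L, ∀ v ∈ L, omega u v = 0

/-- Support of a vector of `V^P`. -/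
def supp (v : QV P) : Set P := {p | v p ≠ 0}

/-- The basis vector `z_p`. -/
def zvec (p : P) : QV P := Pi.single p ((1 : ZMod 2), (0 : ZMod 2))

/-- The basis vector `x_p`. -/
def xvec (p : P) : QV P := Pi.single p ((0 : ZMod 2), (1 : ZMod 2))

/-- Restriction (coordinate projection) of a vector to a subset `S ⊆ P`. -/
def restrTo (S : Set P) (v : QV P) : QV P := fun p => if p ∈ S then v p else 0

/-- The coordinate subspace `V^S ⊆ V^P`. -/
def coordSub (S : Set P) : Submodule (ZMod 2) (QV P) where
  carrier := {v | ∀ p ∉ S, v p = 0}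
  add_mem' := by intro a b ha hb p hp; simp [Pi.add_apply, ha p hp, hb p hp]
  zero_mem' := by intro p _; rfl
  smul_mem' := by intro c a ha p hp; simp [Pi.smul_apply, ha p hp]

/-- `L_S := L ∩ V^S`. -/
def LS (L : Submodule (ZMod 2) (QV P)) (S : Set P) : Submodule (ZMod 2) (QV P) :=
  L ⊓ coordSub S

/-- `L` splits as a direct factor on `S`, i.e. `L = L_S × L_{P∖S}`. -/
def SplitsOn (L : Submodule (ZMod 2) (QV P)) (S : Set P) : Prop :=
  ∀ v ∈ L, restrTo S v ∈ L

/-- `L` splits off a zero factor: on some nonempty `S ⊆ P` all vectors of `L` vanish. -/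
def HasZeroFactor (L : Submodule (ZMod 2) (QV P)) : Prop :=
  ∃ S : Set P, S.Nonempty ∧ ∀ v ∈ L, ∀ p ∈ S, v p = 0

/-- The qubit `p` is trivial: `L` splits off a one-dimensional factor on `{p}`. -/
def TrivialQubit (L : Submodule (ZMod 2) (QV P)) (p : P) : Prop :=
  SplitsOn L {p} ∧ ∃ v ∈ L, v ≠ 0 ∧ supp v ⊆ {p}

/-- `L` splits off a trivial factor. -/
def HasTrivialFactor (L : Submodule (ZMod 2) (QV P)) : Prop :=
  ∃ p : P, TrivialQubit L p

/-- `L` splits off a Bell Lagrangian: an indecomposable Lagrangian direct factor on a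
two-element set of qubits (all of whose nonzero vectors have full support `{p, q}`). -/
def HasBellFactor (L : Submodule (ZMod 2) (QV P)) : Prop :=
  ∃ p q : P, p ≠ q ∧ SplitsOn L {p, q} ∧
    ∃ v ∈ L, ∃ w ∈ L, v ≠ w ∧ supp v = {p, q} ∧ supp w = {p, q} ∧ supp (v + w) = {p, q}

/-- The factor `L_S` (for `S` in a partition) is indecomposable. -/
def IndecompWithin (L : Submodule (ZMod 2) (QV P)) (S : Set P) : Prop :=
  ∀ T ⊆ S, SplitsOn L T → T = ∅ ∨ T = S

/-! ### The Hilbert space, Pauli operators and stabilizer codes -/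

/-- The state space `ℋ^{⊗P} = (ℂ²)^{⊗P}`, realised concretely as functions on
computational basis labels. -/
abbrev HP (P : Type) := (P → Fin 2) → ℂ

/-- Operators on `ℋ^{⊗P}` as matrices. -/
abbrev MatP (P : Type) := Matrix (P → Fin 2) (P → Fin 2) ℂ

/-- The tensor (local) operator `⊗_{p} g_p` on `ℋ^{⊗P}`. -/
def locOp (g : P → Matrix (Fin 2) (Fin 2) ℂ) : MatP P :=
  Matrix.of fun u w => ∏ p, g p (u p) (w p)

def sigmaX : Matrix (Fin 2) (Fin 2) ℂ := !![0, 1; 1, 0]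
def sigmaY : Matrix (Fin 2) (Fin 2) ℂ := !![0, -Complex.I; Complex.I, 0]
def sigmaZ : Matrix (Fin 2) (Fin 2) ℂ := !![1, 0; 0, -1]

/-- The one-qubit Pauli operator `Z^a X^b` attached to `(a, b) ∈ V`. -/
def pauliMat (v : V) : Matrix (Fin 2) (Fin 2) ℂ := sigmaZ ^ (v.1 : ZMod 2).val * sigmaX ^ (v.2 : ZMod 2).val

/-- The Pauli (Weyl) operator attached to `v ∈ V^P`. -/
def Wop (v : QV P) : MatP P := locOp fun p => pauliMat (v p)

/-- A group-homomorphic section `σ` over `L` of the projection from the Pauli group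
`Ṽ^P` onto `V^P`: each value `σ(v)` is a unitary scalar multiple of the Pauli operator
`W(v)`, and `σ` is multiplicative on `L`. -/
structure PauliSection (L : Submodule (ZMod 2) (QV P)) where
  toFun : QV P → MatP P
  scalar : ∀ v : QV P, ∃ c : ℂ, toFun v = c • Wop v
  unitary : ∀ v : QV P, toFun v ∈ Matrix.unitaryGroup (P → Fin 2) ℂ
  mul_of_mem : ∀ u ∈ L, ∀ v ∈ L, toFun (u + v) = toFun u * toFun v
  map_zero : toFun 0 = 1

/-- The stabilizer code `C(L, σ)`: the common fixed-point space of the stabilizer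
group `σ(L)`. -/
def code (L : Submodule (ZMod 2) (QV P)) (σ : PauliSection L) : Submodule ℂ (HP P) where
  carrier := {ψ | ∀ v ∈ L, σ.toFun v *ᵥ ψ = ψ}
  add_mem' := by intro a b ha hb v hv; rw [Matrix.mulVec_add, ha v hv, hb v hv]
  zero_mem' := by intro v hv; simp
  smul_mem' := by intro c a ha v hv; rw [Matrix.mulVec_smul, ha v hv]

/-- The standard section: `σ(v) = W(v)` on `L`. -/
def StandardOn (L : Submodule (ZMod 2) (QV P)) (σ : PauliSection L) : Prop :=
  ∀ v ∈ L, σ.toFun v = Wop v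

/-! ### `SO(3)`, rotations, and the automorphism group of a code -/

/-- `3×3` real matrices. -/
abbrev Rot : Type := Matrix (Fin 3) (Fin 3) ℝ

/-- `SO(3)` as a set of `3×3` real matrices. -/
def SO3 : Set Rot := {A | A * Aᵀ = 1 ∧ A.det = 1}

/-- The ordered Pauli basis (x, y, z) of traceless Hermitian `2×2` matrices. -/
def pauliBasis : Fin 3 → Matrix (Fin 2) (Fin 2) ℂ := ![sigmaX, sigmaY, sigmaZ]

/-- The image of a unitary `u ∈ U(2)` in `SO(3)` under the adjoint action on traceless
Hermitian operators (the identification `U(2)/S¹ = SO(3)`):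
`u σ_j u† = Σ_i (adjRot u)_{ij} σ_i`. -/
def adjRot (u : Matrix (Fin 2) (Fin 2) ℂ) : Rot :=
  Matrix.of fun i j =>
    (1 / 2 : ℝ) * ((pauliBasis i * u * pauliBasis j * u.conjTranspose).trace).re

/-- Rotation about the `x`-axis by angle `θ`. -/
def rotX (θ : ℝ) : Rot := !![1, 0, 0; 0, Real.cos θ, -Real.sin θ; 0, Real.sin θ, Real.cos θ]

/-- Rotation about the `y`-axis by angle `θ`. -/
def rotY (θ : ℝ) : Rot := !![Real.cos θ, 0, Real.sin θ; 0, 1, 0; -Real.sin θ, 0, Real.cos θ]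

/-- Rotation about the `z`-axis by angle `θ`. -/
def rotZ (θ : ℝ) : Rot := !![Real.cos θ, -Real.sin θ, 0; Real.sin θ, Real.cos θ, 0; 0, 0, 1]

/-- The circle group `C_x ⊆ SO(3)` of rotations about the `x`-axis. -/
def Cx : Set Rot := Set.range rotX

/-- The circle group `C_y ⊆ SO(3)` of rotations about the `y`-axis. -/
def Cy : Set Rot := Set.range rotY

/-- The circle group `C_z ⊆ SO(3)` of rotations about the `z`-axis. -/
def Cz : Set Rot := Set.range rotZ

/-- The octahedral group: the subgroup of `SO(3)` generated by the rotations by a right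
angle about the three coordinate axes. -/
def octahedral : Set Rot :=
  (Submonoid.closure {rotX (π / 2), rotY (π / 2), rotZ (π / 2)} : Submonoid Rot)

/-- The infinite dihedral group `D_x ⊆ SO(3)`. -/
def Dx : Set Rot := (Submonoid.closure (Cx ∪ {rotZ π}) : Submonoid Rot)

/-- The infinite dihedral group `D_y ⊆ SO(3)`. -/
def Dy : Set Rot := (Submonoid.closure (Cy ∪ {rotZ π}) : Submonoid Rot)

/-- The infinite dihedral group `D_z ⊆ SO(3)`. -/
def Dz : Set Rot := (Submonoid.closure (Cz ∪ {rotX π}) : Submonoid Rot)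

/-- The automorphism group `A(L, σ) ⊆ SO(3)^P` of the stabilizer code `C(L, σ)`:
all families of rotations admitting a local unitary lift mapping the code into itself. -/
def autSet (L : Submodule (ZMod 2) (QV P)) (σ : PauliSection L) : Set (P → Rot) :=
  {g | ∃ u : P → Matrix (Fin 2) (Fin 2) ℂ,
        (∀ p, u p ∈ Matrix.unitaryGroup (Fin 2) ℂ) ∧
        (∀ p, adjRot (u p) = g p) ∧
        ∀ ψ ∈ code L σ, locOp u *ᵥ ψ ∈ code L σ}

/-- The automorphism group `A(L, σ)_p` at the qubit `p`. -/
def autSetAt (L : Submodule (ZMod 2) (QV P)) (σ : PauliSection L) (p : P) : Set Rot :=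
  (fun g => g p) '' autSet L σ

/-- The normal subgroup `Z(L, σ)` of automorphisms acting by a scalar on the code. -/
def zSet (L : Submodule (ZMod 2) (QV P)) (σ : PauliSection L) : Set (P → Rot) :=
  {g | ∃ u : P → Matrix (Fin 2) (Fin 2) ℂ,
        (∀ p, u p ∈ Matrix.unitaryGroup (Fin 2) ℂ) ∧
        (∀ p, adjRot (u p) = g p) ∧
        ∃ c : ℂ, ∀ ψ ∈ code L σ, locOp u *ᵥ ψ = c • ψ}

/-! ### Restriction to subsets of qubits -/

/-- Restriction of a phase-space vector to the qubits of `S`. -/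
def resQV (S : Set P) (v : QV P) : QV ↥S := fun s => v s

/-- Restriction as a linear map. -/
def resLin (S : Set P) : QV P →ₗ[ZMod 2] QV ↥S where
  toFun := resQV S
  map_add' := by intros; rfl
  map_smul' := by intros; rfl

/-- `L_S`, regarded as a subspace of `V^S`. -/
def LSsub (L : Submodule (ZMod 2) (QV P)) (S : Set P) : Submodule (ZMod 2) (QV ↥S) :=
  Submodule.map (resLin S) (LS L S)

/-- The extension `M ⊗ 1` to `ℋ^{⊗P}` of an operator `M` on `ℋ^{⊗S}`. -/
def extendOp (S : Set P) (M : Matrix (↥S → Fin 2) (↥S → Fin 2) ℂ) : MatP P :=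
  Matrix.of fun u w =>
    if ∀ p ∉ S, u p = w p then M (fun s => u s) (fun s => w s) else 0

/-- `σ'` is the restriction `σ|_{L_S}` of the section `σ` to `L_S`. -/
def RestrictedSection (L : Submodule (ZMod 2) (QV P)) (σ : PauliSection L) (S : Set P)
    (σ' : PauliSection (LSsub L S)) : Prop :=
  ∀ v ∈ LS L S, extendOp S (σ'.toFun (resQV S v)) = σ.toFun v

/-! ### Contiguity, protected and gauge qubits, and normal forms -/

/-- Two qubits are contiguous if they are equal or `L` contains a vector supported
exactly on the pair. -/
def Contig (L : Submodule (ZMod 2) (QV P)) (p q : P) : Prop :=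
  p = q ∨ ∃ v ∈ L, supp v = ({p, q} : Set P)

/-- The contiguity class of a qubit. -/
def contigClass (L : Submodule (ZMod 2) (QV P)) (p : P) : Set P := {q | Contig L p q}

/-- The qubit `p` is protected: the projection `L → V^{{p}}` is surjective. -/
def IsProtected (L : Submodule (ZMod 2) (QV P)) (p : P) : Prop :=
  ∀ w : V, ∃ v ∈ L, v p = w

/-- The qubit `p` is of gauge type: the projection `L → V^{{p}}` has a line as image. -/
def IsGauge (L : Submodule (ZMod 2) (QV P)) (p : P) : Prop :=
  ¬ IsProtected L p ∧ ∃ v ∈ L, v p ≠ 0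

/-- The subspace `⟨z_a + z_b : a ≠ b ∈ S⟩`. -/
def zspan (S : Set P) : Submodule (ZMod 2) (QV P) :=
  Submodule.span (ZMod 2) {w | ∃ a ∈ S, ∃ b ∈ S, a ≠ b ∧ w = zvec a + zvec b}

/-- The vector `Σ_{s ∈ S} x_s`. -/
def xsumOn (S : Set P) : QV P := S.indicator fun _ => ((0 : ZMod 2), (1 : ZMod 2))

/-- Normal form of `L` (conclusion of the normalisation lemma): every contiguity class `S`
carries either `⟨z_a + z_b⟩` or `⟨z_a + z_b⟩ + ⟨Σ_{s∈S} x_s⟩`. -/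
def NormalForm (L : Submodule (ZMod 2) (QV P)) : Prop :=
  ∀ p : P,
    LS L (contigClass L p) = zspan (contigClass L p) ∨
    LS L (contigClass L p) =
      zspan (contigClass L p) ⊔ Submodule.span (ZMod 2) {xsumOn (contigClass L p)}

/-- The pair `(L, σ)` is normalised. -/
def Normalised (L : Submodule (ZMod 2) (QV P)) (σ : PauliSection L) : Prop :=
  NormalForm L ∧
  (∀ p : P, IsGauge L p → contigClass L p = {p} → ∀ v ∈ L, (v p).2 = 0) ∧
  (∀ p : P, IsProtected L p → contigClass L p = {p} →
    connectedComponentIn (autSetAt L σ p) 1 ⊆ Cz) ∧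
  (∀ p : P, IsProtected L p → contigClass L p ≠ {p} →
    LS L (contigClass L p) = zspan (contigClass L p) →
    ∃ v ∈ L, ∀ s ∈ contigClass L p, v s = ((0 : ZMod 2), (1 : ZMod 2))) ∧
  (∀ p q : P, p ≠ q → Contig L p q →
    σ.toFun (zvec p + zvec q) = Wop (zvec p + zvec q))

/-- A local symplectic family of automorphisms of `V`. -/
def IsLocalSymp (f : P → (V ≃ₗ[ZMod 2] V)) : Prop :=
  ∀ (p : P) (u v : V), omegaV (f p u) (f p v) = omegaV u v

/-- The image of `L` under a local (symplectic) transformation. -/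
def mapL (L : Submodule (ZMod 2) (QV P)) (f : P → (V ≃ₗ[ZMod 2] V)) :
    Submodule (ZMod 2) (QV P) :=
  Submodule.map (LinearEquiv.piCongrRight f : QV P ≃ₗ[ZMod 2] QV P).toLinearMap L

/-! ### Abstract group structures carried by subsets of a monoid -/

/-- The set `s` carries the structure of a solvable group. -/
structure SolvableGroupStructure (M : Type) [Monoid M] (s : Set M) where
  G : Type
  [grp : Group G]
  solv : IsSolvable G
  f : G → M
  inj : Function.Injective f
  map_mul : ∀ a b : G, f (a * b) = f a * f b
  range_eq : Set.range f = s

/-- The quotient of the group (carried by) `A` by the normal subgroup (carried by) `Z`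
is a compact solvable topological (Lie) group. -/
structure CompactSolvableQuotientStructure (M : Type) [Monoid M] [TopologicalSpace M]
    (A Z : Set M) where
  G : Type
  [grp : Group G]
  [top : TopologicalSpace G]
  [tgrp : IsTopologicalGroup G]
  cpt : CompactSpace G
  solv : IsSolvable G
  φ : M → G
  cont : ContinuousOn φ A
  map_mul' : ∀ a ∈ A, ∀ b ∈ A, φ (a * b) = φ a * φ b
  surj : ∀ y : G, ∃ a ∈ A, φ a = y
  ker : ∀ a ∈ A, (φ a = 1 ↔ a ∈ Z)

/-! ### Logical qubits and transversally realisable gates -/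

/-- The standard hermitian inner product on a finite-dimensional function space. -/
def innerF {ι : Type} [Fintype ι] (ψ φ : ι → ℂ) : ℂ := ∑ i, (starRingEnd ℂ) (ψ i) * φ i

/-- `e` is a unitary identification of the code space with a space of logical qubits. -/
def IsUnitaryEquiv (L : Submodule (ZMod 2) (QV P)) (σ : PauliSection L) {d : ℕ}
    (e : ↥(code L σ) ≃ₗ[ℂ] HP (Fin d)) : Prop :=
  ∀ ψ φ : ↥(code L σ),
    innerF (e ψ) (e φ) = innerF (ψ : HP P) (φ : HP P)

/-- The operator acting as `w` on the logical qubit `k` and trivially elsewhere. -/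
def oneQubitOp (d : ℕ) (k : Fin d) (w : Matrix (Fin 2) (Fin 2) ℂ) : MatP (Fin d) :=
  locOp fun j => if j = k then w else 1

/-- The set of rotations in `SO(3)` induced, via the identification `e`, on a fixed
logical qubit `k` by (exactly realised) transversal gates, i.e. by elements of `A(L, σ)`. -/
def logicalSet (L : Submodule (ZMod 2) (QV P)) (σ : PauliSection L) {d : ℕ}
    (e : ↥(code L σ) ≃ₗ[ℂ] HP (Fin d)) (k : Fin d) : Set Rot :=
  {A | ∃ w ∈ Matrix.unitaryGroup (Fin 2) ℂ, adjRot w = A ∧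
        ∃ u : P → Matrix (Fin 2) (Fin 2) ℂ,
          (∀ p, u p ∈ Matrix.unitaryGroup (Fin 2) ℂ) ∧
          ∀ φ : HP (Fin d),
            locOp u *ᵥ ((e.symm φ : HP P)) = ((e.symm (oneQubitOp d k w *ᵥ φ) : HP P))}

/-! ### Reed–Muller codes -/

/-- The qubit set `P = 𝔽₂^m ∖ {0}`. -/
abbrev RMQubits (m : ℕ) := {s : Fin m → ZMod 2 // s ≠ 0}

/-- Polynomial functions on `𝔽₂^m` of degree at most `r` with zero constant term. -/
def RMspan (r m : ℕ) : Submodule (ZMod 2) ((Fin m → ZMod 2) → ZMod 2) :=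
  Submodule.span (ZMod 2)
    {f | ∃ I : Finset (Fin m), I.Nonempty ∧ I.card ≤ r ∧ f = fun s => ∏ i ∈ I, s i}

/-- The shortened Reed–Muller code `R_*(r, m) ⊆ 𝔽₂^P`. -/
def RMstar (r m : ℕ) : Submodule (ZMod 2) (RMQubits m → ZMod 2) :=
  Submodule.map (LinearMap.funLeft (ZMod 2) (ZMod 2) Subtype.val) (RMspan r m)

/-- The `z`-part of a phase-space vector. -/
def zPart {P : Type} : QV P →ₗ[ZMod 2] (P → ZMod 2) where
  toFun v := fun p => (v p).1
  map_add' := by intros; rfl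
  map_smul' := by intros; rfl

/-- The `x`-part of a phase-space vector. -/
def xPart {P : Type} : QV P →ₗ[ZMod 2] (P → ZMod 2) where
  toFun v := fun p => (v p).2
  map_add' := by intros; rfl
  map_smul' := by intros; rfl

/-- The Calderbank–Shor–Steane isotropic subspace built from the shortened Reed–Muller
codes `R_*(m−2, m)` (in the `z`-coordinates) and `R_*(1, m)` (in the `x`-coordinates). -/
def cssL (m : ℕ) : Submodule (ZMod 2) (QV (RMQubits m)) :=
  Submodule.comap zPart (RMstar (m - 2) m) ⊓ Submodule.comap xPart (RMstar 1 m)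

/-- The stabilizer state `|0⟩_S ⊗ |0⟩_T + |0⟩_S ⊗ |1⟩_T + |1⟩_S ⊗ |0⟩_T − |1⟩_S ⊗ |1⟩_T`
(with `T = Sᶜ`), written in the computational basis. -/
def bellLike (S : Set P) (p q : P) : HP P := fun u =>
  if (∀ a ∈ S, u a = u p) ∧ (∀ a ∈ Sᶜ, u a = u q) then
    ((-1 : ℂ)) ^ ((u p : Fin 2).val * (u q : Fin 2).val) else 0


/-! ### Rotations fixing a coordinate axis, and signed permutation matrices -/

lemma exists_cos_sin {a b : ℝ} (h : a ^ 2 + b ^ 2 = 1) :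
    ∃ θ : ℝ, Real.cos θ = a ∧ Real.sin θ = b := by
  have hn : ‖(⟨a, b⟩ : ℂ)‖ = 1 := by
    rw [Complex.norm_def, Complex.normSq_mk, Real.sqrt_eq_one]; linarith
  have h0 : (⟨a, b⟩ : ℂ) ≠ 0 := by
    intro h0; rw [h0] at hn; simp at hn
  refine ⟨Complex.arg ⟨a, b⟩, ?_, ?_⟩
  · rw [Complex.cos_arg h0, hn]; simp
  · rw [Complex.sin_arg, hn]; simp

lemma SO3_mul {A B : Rot} (hA : A ∈ SO3) (hB : B ∈ SO3) : A * B ∈ SO3 := by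
  refine ⟨?_, by rw [Matrix.det_mul, hA.2, hB.2, one_mul]⟩
  rw [Matrix.transpose_mul, Matrix.mul_assoc, ← Matrix.mul_assoc B, hB.1, Matrix.one_mul, hA.1]

lemma rotX_mem_SO3 (θ : ℝ) : rotX θ ∈ SO3 := by
  have h := Real.sin_sq_add_cos_sq θ
  constructor
  · ext i j
    fin_cases i <;> fin_cases j <;>
      simp [rotX, Matrix.mul_apply, Fin.sum_univ_three] <;> linarith
  · simp [rotX, Matrix.det_fin_three]; linarith

lemma rotY_mem_SO3 (θ : ℝ) : rotY θ ∈ SO3 := by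
  have h := Real.sin_sq_add_cos_sq θ
  constructor
  · ext i j
    fin_cases i <;> fin_cases j <;>
      simp [rotY, Matrix.mul_apply, Fin.sum_univ_three] <;> linarith
  · simp [rotY, Matrix.det_fin_three]; linarith

lemma rotZ_mem_SO3 (θ : ℝ) : rotZ θ ∈ SO3 := by
  have h := Real.sin_sq_add_cos_sq θ
  constructor
  · ext i j
    fin_cases i <;> fin_cases j <;>
      simp [rotZ, Matrix.mul_apply, Fin.sum_univ_three] <;> linarith
  · simp [rotZ, Matrix.det_fin_three]; linarith

lemma SO3.row {A : Rot} (hA : A ∈ SO3) (i j : Fin 3) :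
    A i 0 * A j 0 + A i 1 * A j 1 + A i 2 * A j 2 = if i = j then 1 else 0 := by
  have := congrFun (congrFun hA.1 i) j
  simpa [Matrix.mul_apply, Fin.sum_univ_three, Matrix.one_apply] using this

lemma SO3.col {A : Rot} (hA : A ∈ SO3) (i j : Fin 3) :
    A 0 i * A 0 j + A 1 i * A 1 j + A 2 i * A 2 j = if i = j then 1 else 0 := by
  have := congrFun (congrFun (show Aᵀ * A = 1 from mul_eq_one_comm.mp hA.1) i) j
  simpa [Matrix.mul_apply, Fin.sum_univ_three, Matrix.one_apply] using this

lemma eq_and_eq_neg_of_unit {a b c d : ℝ} (h1 : a ^ 2 + b ^ 2 = 1) (h2 : c ^ 2 + d ^ 2 = 1)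
    (h3 : a * d - b * c = 1) : d = a ∧ c = -b := by
  have : (a - d) ^ 2 + (b + c) ^ 2 = 0 := by nlinarith
  constructor <;> nlinarith [sq_nonneg (a - d), sq_nonneg (b + c)]

lemma exists_rotX {A : Rot} (hA : A ∈ SO3) (h : A 0 0 = 1) : ∃ θ, A = rotX θ := by
  have r0 := SO3.row hA 0 0
  have c0 := SO3.col hA 0 0
  have r1 := SO3.row hA 1 1
  have r2 := SO3.row hA 2 2
  have hd := hA.2
  rw [Matrix.det_fin_three] at hd
  simp only [if_true, h] at r0 c0 r1 r2 hd
  have h01 : A 0 1 = 0 := by nlinarith [sq_nonneg (A 0 1), sq_nonneg (A 0 2)]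
  have h02 : A 0 2 = 0 := by nlinarith [sq_nonneg (A 0 1), sq_nonneg (A 0 2)]
  have h10 : A 1 0 = 0 := by nlinarith [sq_nonneg (A 1 0), sq_nonneg (A 2 0)]
  have h20 : A 2 0 = 0 := by nlinarith [sq_nonneg (A 1 0), sq_nonneg (A 2 0)]
  simp only [h01, h02, h10, h20] at r1 r2 hd
  obtain ⟨e1, e2⟩ := eq_and_eq_neg_of_unit (a := A 1 1) (b := A 1 2) (c := A 2 1) (d := A 2 2)
    (by linarith) (by linarith) (by linarith)
  obtain ⟨θ, hc, hs⟩ := exists_cos_sin (a := A 1 1) (b := A 2 1) (by rw [e2]; linarith)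
  refine ⟨θ, ?_⟩
  ext i j
  fin_cases i <;> fin_cases j <;> simp [rotX, h, h01, h02, h10, h20, hc, hs, e1, e2]

lemma exists_rotY {A : Rot} (hA : A ∈ SO3) (h : A 1 1 = 1) : ∃ θ, A = rotY θ := by
  have r0 := SO3.row hA 1 1
  have c0 := SO3.col hA 1 1
  have r1 := SO3.row hA 0 0
  have r2 := SO3.row hA 2 2
  have hd := hA.2
  rw [Matrix.det_fin_three] at hd
  simp only [if_true, h] at r0 c0 r1 r2 hd
  have h01 : A 1 0 = 0 := by nlinarith [sq_nonneg (A 1 0), sq_nonneg (A 1 2)]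
  have h02 : A 1 2 = 0 := by nlinarith [sq_nonneg (A 1 0), sq_nonneg (A 1 2)]
  have h10 : A 0 1 = 0 := by nlinarith [sq_nonneg (A 0 1), sq_nonneg (A 2 1)]
  have h20 : A 2 1 = 0 := by nlinarith [sq_nonneg (A 0 1), sq_nonneg (A 2 1)]
  simp only [h01, h02, h10, h20] at r1 r2 hd
  obtain ⟨e1, e2⟩ := eq_and_eq_neg_of_unit (a := A 0 0) (b := A 0 2) (c := A 2 0) (d := A 2 2)
    (by linarith) (by linarith) (by linarith)
  obtain ⟨θ, hc, hs⟩ := exists_cos_sin (a := A 0 0) (b := A 0 2) (by linarith)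
  refine ⟨θ, ?_⟩
  ext i j
  fin_cases i <;> fin_cases j <;> simp [rotY, h, h01, h02, h10, h20, hc, hs, e1, e2]

lemma exists_rotZ {A : Rot} (hA : A ∈ SO3) (h : A 2 2 = 1) : ∃ θ, A = rotZ θ := by
  have r0 := SO3.row hA 2 2
  have c0 := SO3.col hA 2 2
  have r1 := SO3.row hA 0 0
  have r2 := SO3.row hA 1 1
  have hd := hA.2
  rw [Matrix.det_fin_three] at hd
  simp only [if_true, h] at r0 c0 r1 r2 hd
  have h01 : A 2 0 = 0 := by nlinarith [sq_nonneg (A 2 0), sq_nonneg (A 2 1)]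
  have h02 : A 2 1 = 0 := by nlinarith [sq_nonneg (A 2 0), sq_nonneg (A 2 1)]
  have h10 : A 0 2 = 0 := by nlinarith [sq_nonneg (A 0 2), sq_nonneg (A 1 2)]
  have h20 : A 1 2 = 0 := by nlinarith [sq_nonneg (A 0 2), sq_nonneg (A 1 2)]
  simp only [h01, h02, h10, h20] at r1 r2 hd
  obtain ⟨e1, e2⟩ := eq_and_eq_neg_of_unit (a := A 0 0) (b := A 0 1) (c := A 1 0) (d := A 1 1)
    (by linarith) (by linarith) (by linarith)
  obtain ⟨θ, hc, hs⟩ := exists_cos_sin (a := A 0 0) (b := A 1 0) (by rw [e2]; linarith)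
  refine ⟨θ, ?_⟩
  ext i j
  fin_cases i <;> fin_cases j <;> simp [rotZ, h, h01, h02, h10, h20, hc, hs, e1, e2]

lemma rotX_pi_mul_self : rotX π * rotX π = 1 := by
  ext i j
  fin_cases i <;> fin_cases j <;> simp [rotX, Matrix.mul_apply, Fin.sum_univ_three]

lemma rotZ_pi_mul_self : rotZ π * rotZ π = 1 := by
  ext i j
  fin_cases i <;> fin_cases j <;> simp [rotZ, Matrix.mul_apply, Fin.sum_univ_three]

lemma mem_Dx {A : Rot} (hA : A ∈ SO3) (h1 : A 1 0 = 0) (h2 : A 2 0 = 0) : A ∈ Dx := by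
  have hc := SO3.col hA 0 0
  simp only [h1, h2, if_true] at hc
  have hs : A 0 0 = 1 ∨ A 0 0 = -1 := mul_self_eq_one_iff.mp (by linarith)
  obtain hs | hs := hs
  · obtain ⟨θ, rfl⟩ := exists_rotX hA hs
    exact Submonoid.subset_closure (Or.inl ⟨θ, rfl⟩)
  · obtain ⟨θ, hθ⟩ := exists_rotX (SO3_mul (rotZ_mem_SO3 π) hA)
      (by simp [rotZ, Matrix.mul_apply, Fin.sum_univ_three, hs])
    have : A = rotZ π * rotX θ := by
      rw [← hθ, ← Matrix.mul_assoc, rotZ_pi_mul_self, Matrix.one_mul]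
    rw [this]
    exact Submonoid.mul_mem _ (Submonoid.subset_closure (Or.inr rfl))
      (Submonoid.subset_closure (Or.inl ⟨θ, rfl⟩))

lemma mem_Dy {A : Rot} (hA : A ∈ SO3) (h1 : A 0 1 = 0) (h2 : A 2 1 = 0) : A ∈ Dy := by
  have hc := SO3.col hA 1 1
  simp only [h1, h2, if_true] at hc
  have hs : A 1 1 = 1 ∨ A 1 1 = -1 := mul_self_eq_one_iff.mp (by linarith)
  obtain hs | hs := hs
  · obtain ⟨θ, rfl⟩ := exists_rotY hA hs
    exact Submonoid.subset_closure (Or.inl ⟨θ, rfl⟩)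
  · obtain ⟨θ, hθ⟩ := exists_rotY (SO3_mul (rotZ_mem_SO3 π) hA)
      (by simp [rotZ, Matrix.mul_apply, Fin.sum_univ_three, hs])
    have : A = rotZ π * rotY θ := by
      rw [← hθ, ← Matrix.mul_assoc, rotZ_pi_mul_self, Matrix.one_mul]
    rw [this]
    exact Submonoid.mul_mem _ (Submonoid.subset_closure (Or.inr rfl))
      (Submonoid.subset_closure (Or.inl ⟨θ, rfl⟩))

lemma mem_Dz {A : Rot} (hA : A ∈ SO3) (h1 : A 0 2 = 0) (h2 : A 1 2 = 0) : A ∈ Dz := by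
  have hc := SO3.col hA 2 2
  simp only [h1, h2, if_true] at hc
  have hs : A 2 2 = 1 ∨ A 2 2 = -1 := mul_self_eq_one_iff.mp (by linarith)
  obtain hs | hs := hs
  · obtain ⟨θ, rfl⟩ := exists_rotZ hA hs
    exact Submonoid.subset_closure (Or.inl ⟨θ, rfl⟩)
  · obtain ⟨θ, hθ⟩ := exists_rotZ (SO3_mul (rotX_mem_SO3 π) hA)
      (by simp [rotX, Matrix.mul_apply, Fin.sum_univ_three, hs])
    have : A = rotX π * rotZ θ := by
      rw [← hθ, ← Matrix.mul_assoc, rotX_pi_mul_self, Matrix.one_mul]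
    rw [this]
    exact Submonoid.mul_mem _ (Submonoid.subset_closure (Or.inr rfl))
      (Submonoid.subset_closure (Or.inl ⟨θ, rfl⟩))

/-- Every row of `A` has at most one nonzero entry. -/
def RowMonomial (A : Rot) : Prop := ∀ i j j' : Fin 3, j ≠ j' → A i j = 0 ∨ A i j' = 0

lemma rotX_mem_octahedral : rotX (π / 2) ∈ octahedral := Submonoid.subset_closure (by simp)

lemma rotY_mem_octahedral : rotY (π / 2) ∈ octahedral := Submonoid.subset_closure (by simp)

lemma rotZ_mem_octahedral : rotZ (π / 2) ∈ octahedral := Submonoid.subset_closure (by simp)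

lemma octahedral_mul {A B : Rot} (hA : A ∈ octahedral) (hB : B ∈ octahedral) :
    A * B ∈ octahedral := Submonoid.mul_mem _ hA hB

lemma mem_octahedral_of_eq_one {A : Rot} (hA : A ∈ SO3) (hm : RowMonomial A)
    (h : A 0 0 = 1) : A ∈ octahedral := by
  obtain ⟨θ, rfl⟩ := exists_rotX hA h
  have hsc := Real.sin_sq_add_cos_sq θ
  have hX := rotX_mem_octahedral
  have h1 : Real.cos θ = 0 ∨ Real.sin θ = 0 := by
    simpa [rotX] using hm 1 1 2 (by decide)
  obtain h1 | h1 := h1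
  · have hs : Real.sin θ = 1 ∨ Real.sin θ = -1 := by
      rw [← sq_eq_one_iff]; rw [h1] at hsc; linarith
    obtain hs | hs := hs
    · convert hX using 1
      ext i j
      fin_cases i <;> fin_cases j <;> simp [rotX, h1, hs]
    · convert octahedral_mul hX (octahedral_mul hX hX) using 1
      ext i j
      fin_cases i <;> fin_cases j <;>
        simp [rotX, h1, hs, Matrix.mul_apply, Fin.sum_univ_three]
  · have hs : Real.cos θ = 1 ∨ Real.cos θ = -1 := by
      rw [← sq_eq_one_iff]; rw [h1] at hsc; linarith
    obtain hs | hs := hs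
    · have h1 : rotX θ = 1 := by
        ext i j
        fin_cases i <;> fin_cases j <;> simp [rotX, h1, hs]
      rw [h1]
      exact Submonoid.one_mem _
    · convert octahedral_mul hX hX using 1
      ext i j
      fin_cases i <;> fin_cases j <;>
        simp [rotX, h1, hs, Matrix.mul_apply, Fin.sum_univ_three]

lemma mem_octahedral_of_ne_zero {A : Rot} (hA : A ∈ SO3) (hm : RowMonomial A)
    (h : A 0 0 ≠ 0) : A ∈ octahedral := by
  have h1 := (hm 0 0 1 (by decide)).resolve_left h
  have h2 := (hm 0 0 2 (by decide)).resolve_left h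
  have hr := SO3.row hA 0 0
  simp only [h1, h2, if_true] at hr
  have hs : A 0 0 = 1 ∨ A 0 0 = -1 := mul_self_eq_one_iff.mp (by linarith)
  obtain hs | hs := hs
  · exact mem_octahedral_of_eq_one hA hm hs
  · have hZ2 : rotZ (π / 2) * rotZ (π / 2) = rotZ π := by
      ext i j
      fin_cases i <;> fin_cases j <;> simp [rotZ, Matrix.mul_apply, Fin.sum_univ_three]
    have hZ : rotZ π ∈ octahedral := by
      rw [← hZ2]; exact octahedral_mul rotZ_mem_octahedral rotZ_mem_octahedral
    have : A = rotZ π * (rotZ π * A) := by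
      rw [← Matrix.mul_assoc, rotZ_pi_mul_self, Matrix.one_mul]
    rw [this]
    refine octahedral_mul hZ (mem_octahedral_of_eq_one (SO3_mul (rotZ_mem_SO3 π) hA) ?_ ?_)
    · intro i j j' hj
      have := hm i j j' hj
      fin_cases i <;> simpa [rotZ, Matrix.mul_apply, Fin.sum_univ_three] using this
    · simp [rotZ, Matrix.mul_apply, Fin.sum_univ_three, hs]

lemma mem_octahedral {A : Rot} (hA : A ∈ SO3) (hm : RowMonomial A) : A ∈ octahedral := by
  by_cases h0 : A 0 0 = 0
  · by_cases h1 : A 0 1 = 0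
    · have h2 : A 0 2 ≠ 0 := by
        intro h2
        have hr := SO3.row hA 0 0
        simp [h0, h1, h2] at hr
      have hY4 : rotY (π / 2) * (rotY (π / 2) * (rotY (π / 2) * rotY (π / 2))) = 1 := by
        ext i j
        fin_cases i <;> fin_cases j <;> simp [rotY, Matrix.mul_apply, Fin.sum_univ_three]
      have hY := rotY_mem_octahedral
      have : A = A * rotY (π / 2) * (rotY (π / 2) * (rotY (π / 2) * rotY (π / 2))) := by
        rw [Matrix.mul_assoc, hY4, Matrix.mul_one]
      rw [this]
      refine octahedral_mul (mem_octahedral_of_ne_zero (SO3_mul hA (rotY_mem_SO3 _)) ?_ ?_)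
        (octahedral_mul hY (octahedral_mul hY hY))
      · intro i j j' hj
        have a := hm i 0 1 (by decide)
        have b := hm i 0 2 (by decide)
        have c := hm i 1 2 (by decide)
        fin_cases j <;> fin_cases j' <;>
          simp [rotY, Matrix.mul_apply, Fin.sum_univ_three] at hj ⊢ <;> tauto
      · simpa [rotY, Matrix.mul_apply, Fin.sum_univ_three] using h2
    · have hZ4 : rotZ (π / 2) * (rotZ (π / 2) * (rotZ (π / 2) * rotZ (π / 2))) = 1 := by
        ext i j
        fin_cases i <;> fin_cases j <;> simp [rotZ, Matrix.mul_apply, Fin.sum_univ_three]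
      have hZ := rotZ_mem_octahedral
      have : A = A * rotZ (π / 2) * (rotZ (π / 2) * (rotZ (π / 2) * rotZ (π / 2))) := by
        rw [Matrix.mul_assoc, hZ4, Matrix.mul_one]
      rw [this]
      refine octahedral_mul (mem_octahedral_of_ne_zero (SO3_mul hA (rotZ_mem_SO3 _)) ?_ ?_)
        (octahedral_mul hZ (octahedral_mul hZ hZ))
      · intro i j j' hj
        have a := hm i 0 1 (by decide)
        have b := hm i 0 2 (by decide)
        have c := hm i 1 2 (by decide)
        fin_cases j <;> fin_cases j' <;>
          simp [rotZ, Matrix.mul_apply, Fin.sum_univ_three] at hj ⊢ <;> tauto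
      · simpa [rotZ, Matrix.mul_apply, Fin.sum_univ_three] using h1
  · exact mem_octahedral_of_ne_zero hA hm h0

/-! ### The adjoint action of `U(2)` -/

lemma eq_sum_pauliBasis {M : Matrix (Fin 2) (Fin 2) ℂ} (hM : Mᴴ = M) (ht : M.trace = 0) :
    M = ∑ i, (((1 / 2 : ℝ) * ((pauliBasis i * M).trace).re : ℝ) : ℂ) • pauliBasis i := by
  have h00 := congrFun (congrFun hM 0) 0
  have h01 := congrFun (congrFun hM 0) 1
  have h11 := congrFun (congrFun hM 1) 1
  simp only [Matrix.conjTranspose_apply, Complex.ext_iff] at h00 h01 h11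
  simp only [Matrix.trace_fin_two, Complex.ext_iff] at ht
  simp at h00 h01 h11 ht
  ext i j
  fin_cases i <;> fin_cases j <;>
    simp [pauliBasis, sigmaX, sigmaY, sigmaZ, Fin.sum_univ_three, Matrix.trace_fin_two,
      Matrix.mul_apply, Fin.sum_univ_two, Complex.ext_iff] <;>
    constructor <;> linarith

lemma pauliBasis_conjTranspose (i : Fin 3) : (pauliBasis i)ᴴ = pauliBasis i := by
  ext a b
  fin_cases i <;> fin_cases a <;> fin_cases b <;> simp [pauliBasis, sigmaX, sigmaY, sigmaZ]

lemma trace_pauliBasis (i : Fin 3) : (pauliBasis i).trace = 0 := by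
  fin_cases i <;> simp [pauliBasis, sigmaX, sigmaY, sigmaZ, Matrix.trace_fin_two]

lemma conj_pauliBasis {u : Matrix (Fin 2) (Fin 2) ℂ} (hu : u ∈ Matrix.unitaryGroup (Fin 2) ℂ)
    (j : Fin 3) : u * pauliBasis j * uᴴ = ∑ i, (adjRot u i j : ℂ) • pauliBasis i := by
  have h := eq_sum_pauliBasis (M := u * pauliBasis j * uᴴ)
    (by simp [Matrix.conjTranspose_mul, pauliBasis_conjTranspose, Matrix.mul_assoc])
    (by
      rw [Matrix.trace_mul_comm, ← Matrix.mul_assoc, ← Matrix.star_eq_conjTranspose,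
        Matrix.mem_unitaryGroup_iff'.mp hu, Matrix.one_mul, trace_pauliBasis])
  simpa only [adjRot, Matrix.of_apply, Matrix.mul_assoc] using h

lemma adjRot_mem_SO3 {u : Matrix (Fin 2) (Fin 2) ℂ}
    (hu : u ∈ Matrix.unitaryGroup (Fin 2) ℂ) : adjRot u ∈ SO3 := by
  have huu : uᴴ * u = 1 := Matrix.mem_unitaryGroup_iff'.mp hu
  have hmul : ∀ M N : Matrix (Fin 2) (Fin 2) ℂ, (u * M * uᴴ) * (u * N * uᴴ) = u * (M * N) * uᴴ := by
    intro M N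
    calc (u * M * uᴴ) * (u * N * uᴴ) = u * M * (uᴴ * u) * N * uᴴ := by noncomm_ring
      _ = _ := by rw [huu]; noncomm_ring
  have htr : ∀ M : Matrix (Fin 2) (Fin 2) ℂ, (u * M * uᴴ).trace = M.trace := by
    intro M
    rw [Matrix.trace_mul_comm, ← Matrix.mul_assoc, huu, Matrix.one_mul]
  have h2 : ∀ i j, ((u * pauliBasis i * uᴴ) * (u * pauliBasis j * uᴴ)).trace =
      (pauliBasis i * pauliBasis j).trace := fun i j => by rw [hmul, htr]
  have h3 : ((u * pauliBasis 0 * uᴴ) * (u * pauliBasis 1 * uᴴ) *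
      (u * pauliBasis 2 * uᴴ)).trace = (pauliBasis 0 * pauliBasis 1 * pauliBasis 2).trace := by
    rw [hmul, hmul, htr]
  simp only [conj_pauliBasis hu] at h2 h3
  generalize adjRot u = A at h2 h3
  refine ⟨mul_eq_one_comm.mp ?_, ?_⟩
  · ext i j
    have h := congrArg Complex.re (h2 i j)
    fin_cases i <;> fin_cases j <;>
      simp [pauliBasis, sigmaX, sigmaY, sigmaZ, Fin.sum_univ_three, Matrix.trace_fin_two,
        Matrix.mul_apply] at h ⊢ <;> linarith
  · have h := congrArg Complex.im h3
    simp [pauliBasis, sigmaX, sigmaY, sigmaZ, Fin.sum_univ_three, Matrix.trace_fin_two] at h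
    rw [Matrix.det_fin_three]
    linarith

/-! ### Traces of conjugated one-qubit Pauli operators -/

/-- The matrix entries (up to scalars) of the adjoint action of `u` in the Pauli basis. -/
def conjTr (u : Matrix (Fin 2) (Fin 2) ℂ) (a b : V) : ℂ :=
  (pauliMat a * (u * pauliMat b * uᴴ)).trace

lemma V_forall {C : V → Prop} (h0 : C 0) (hx : C (0, 1)) (hy : C (1, 1)) (hz : C (1, 0)) :
    ∀ v, C v := by
  rintro ⟨a, b⟩
  fin_cases a <;> fin_cases b <;> assumption

lemma V_cases {a : V} (h : a ≠ 0) : a = (0, 1) ∨ a = (1, 1) ∨ a = (1, 0) := by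
  revert a; decide

lemma pauliMat_zero : pauliMat 0 = 1 := by simp [pauliMat]

lemma pauliMat_x : pauliMat (0, 1) = sigmaX := by simp [pauliMat, ZMod.val_one]

lemma pauliMat_z : pauliMat (1, 0) = sigmaZ := by simp [pauliMat, ZMod.val_one]

lemma pauliMat_y : pauliMat (1, 1) = Complex.I • sigmaY := by
  ext i j
  fin_cases i <;> fin_cases j <;>
    simp [pauliMat, sigmaX, sigmaY, sigmaZ, ZMod.val_one, Matrix.mul_apply]

lemma trace_pauliMat {a : V} (h : a ≠ 0) : (pauliMat a).trace = 0 := by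
  obtain rfl | rfl | rfl := V_cases h <;>
    simp [pauliMat_x, pauliMat_y, pauliMat_z, sigmaX, sigmaY, sigmaZ, Matrix.trace_fin_two]

lemma conjTr_zero_left {u : Matrix (Fin 2) (Fin 2) ℂ} (hu : uᴴ * u = 1) {b : V} (hb : b ≠ 0) :
    conjTr u 0 b = 0 := by
  rw [conjTr, pauliMat_zero, Matrix.one_mul, Matrix.trace_mul_comm, ← Matrix.mul_assoc, hu,
    Matrix.one_mul, trace_pauliMat hb]

lemma conjTr_zero_right {u : Matrix (Fin 2) (Fin 2) ℂ} (hu : u * uᴴ = 1) {b : V} (hb : b ≠ 0) :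
    conjTr u b 0 = 0 := by
  rw [conjTr, pauliMat_zero, Matrix.mul_one, hu, Matrix.mul_one, trace_pauliMat hb]

lemma conjTr_one_ne_zero_iff (a b : V) : conjTr 1 a b ≠ 0 ↔ a = b := by
  revert a b
  refine V_forall ?_ ?_ ?_ ?_ <;> refine V_forall ?_ ?_ ?_ ?_ <;>
    simp [conjTr, pauliMat_zero, pauliMat_x, pauliMat_y, pauliMat_z, sigmaX, sigmaY, sigmaZ,
      Matrix.trace_fin_two] <;> decide

/-- The vector of `V` attached to a coordinate axis. -/
def axisVec : Fin 3 → V := ![(0, 1), (1, 1), (1, 0)]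

lemma axisVec_ne_zero (i : Fin 3) : axisVec i ≠ 0 := by revert i; decide

lemma axisVec_injective : Function.Injective axisVec := by decide

lemma exists_smul_pauliMat (i : Fin 3) : ∃ c : ℂ, pauliBasis i = c • pauliMat (axisVec i) := by
  fin_cases i
  · exact ⟨1, by simp [axisVec, pauliMat_x, pauliBasis]⟩
  · exact ⟨-Complex.I, by simp [axisVec, pauliMat_y, pauliBasis, smul_smul]⟩
  · exact ⟨1, by simp [axisVec, pauliMat_z, pauliBasis]⟩

lemma adjRot_eq_zero (u : Matrix (Fin 2) (Fin 2) ℂ) (i j : Fin 3)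
    (h : conjTr u (axisVec i) (axisVec j) = 0) : adjRot u i j = 0 := by
  obtain ⟨c, hc⟩ := exists_smul_pauliMat i
  obtain ⟨d, hd⟩ := exists_smul_pauliMat j
  rw [conjTr] at h
  simp [adjRot, hc, hd, Matrix.mul_assoc] at h ⊢
  simp [h]

/-! ### Local operators -/

lemma locOp_mul (g h : P → Matrix (Fin 2) (Fin 2) ℂ) :
    locOp g * locOp h = locOp fun s => g s * h s := by
  ext u w
  simp only [locOp, Matrix.mul_apply, Matrix.of_apply, ← Finset.prod_mul_distrib]
  rw [Finset.prod_univ_sum, Fintype.piFinset_univ]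

lemma locOp_one : locOp (fun _ : P => (1 : Matrix (Fin 2) (Fin 2) ℂ)) = 1 := by
  ext u w
  simp only [locOp, Matrix.of_apply, Matrix.one_apply, Finset.prod_ite_zero, funext_iff]
  simp

lemma locOp_conjTranspose (g : P → Matrix (Fin 2) (Fin 2) ℂ) :
    (locOp g)ᴴ = locOp fun s => (g s)ᴴ := by
  ext u w
  simp [locOp]

lemma trace_locOp (g : P → Matrix (Fin 2) (Fin 2) ℂ) : (locOp g).trace = ∏ s, (g s).trace := by
  simp only [locOp, Matrix.trace, Matrix.diag_apply, Matrix.of_apply]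
  rw [Finset.prod_univ_sum, Fintype.piFinset_univ]

lemma trace_Wop_mul_conj (g : P → Matrix (Fin 2) (Fin 2) ℂ) (w v : QV P) :
    (Wop w * (locOp g * Wop v * (locOp g)ᴴ)).trace = ∏ s, conjTr (g s) (w s) (v s) := by
  rw [Wop, Wop, locOp_conjTranspose, locOp_mul, locOp_mul, locOp_mul, trace_locOp]
  rfl

/-! ### Invariance of the code projector -/

open scoped ComplexOrder in
/-- A unitary leaving the range of an orthogonal projection invariant commutes with it. -/
lemma conj_proj_eq {n : Type} [Fintype n] [DecidableEq n] {Q U : Matrix n n ℂ} (hQ : Qᴴ = Q)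
    (hQQ : Q * Q = Q) (hU : Uᴴ * U = 1) (h : Q * (U * Q) = U * Q) : U * Q * Uᴴ = Q := by
  set A := U * Q * Uᴴ with hA
  have hAh : Aᴴ = A := by
    simp [hA, Matrix.conjTranspose_mul, hQ, Matrix.mul_assoc]
  have hQA : Q * A = A := by rw [hA, ← Matrix.mul_assoc, h]
  have hAQ : A * Q = A := by
    have := congrArg Matrix.conjTranspose hQA
    rwa [Matrix.conjTranspose_mul, hAh, hQ] at this
  have hAA : A * A = A := by
    calc A * A = U * Q * (Uᴴ * U) * Q * Uᴴ := by rw [hA]; noncomm_ring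
      _ = U * (Q * Q) * Uᴴ := by rw [hU]; noncomm_ring
      _ = A := by rw [hQQ]
  have htr : A.trace = Q.trace := by
    rw [hA, Matrix.trace_mul_comm, ← Matrix.mul_assoc, hU, Matrix.one_mul]
  have h0 : ((Q - A)ᴴ * (Q - A)).trace = 0 := by
    rw [Matrix.conjTranspose_sub, hQ, hAh, Matrix.mul_sub, Matrix.sub_mul, Matrix.sub_mul, hQQ,
      hAQ, hQA, hAA]
    simp [htr]
  have := Matrix.trace_conjTranspose_mul_self_eq_zero_iff.mp h0
  exact (sub_eq_zero.mp this).symm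

/-- The (unnormalised) projector onto the code. -/
def stabSum (L : Submodule (ZMod 2) (QV P)) (σ : PauliSection L) : MatP P :=
  ∑ v : L, σ.toFun v

lemma toFun_mul_stabSum (L : Submodule (ZMod 2) (QV P)) (σ : PauliSection L) {v : QV P}
    (hv : v ∈ L) : σ.toFun v * stabSum L σ = stabSum L σ := by
  rw [stabSum, Finset.mul_sum]
  refine Fintype.sum_equiv (Equiv.addLeft (⟨v, hv⟩ : L)) _ _ fun w => ?_
  simp [σ.mul_of_mem v hv w w.2]

lemma toFun_conjTranspose (L : Submodule (ZMod 2) (QV P)) (σ : PauliSection L) {v : QV P}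
    (hv : v ∈ L) : (σ.toFun v)ᴴ = σ.toFun v := by
  have h1 : σ.toFun v * σ.toFun v = 1 := by
    rw [← σ.mul_of_mem v hv v hv, ← two_smul (ZMod 2) v, show (2 : ZMod 2) = 0 from rfl,
      zero_smul, σ.map_zero]
  have h2 : (σ.toFun v)ᴴ * σ.toFun v = 1 := Matrix.mem_unitaryGroup_iff'.mp (σ.unitary v)
  calc (σ.toFun v)ᴴ = (σ.toFun v)ᴴ * (σ.toFun v * σ.toFun v) := by rw [h1, Matrix.mul_one]
    _ = σ.toFun v := by rw [← Matrix.mul_assoc, h2, Matrix.one_mul]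

lemma conj_stabSum (L : Submodule (ZMod 2) (QV P)) (σ : PauliSection L) {U : MatP P}
    (hU : Uᴴ * U = 1) (hcode : ∀ ψ ∈ code L σ, U *ᵥ ψ ∈ code L σ) :
    U * stabSum L σ * Uᴴ = stabSum L σ := by
  have hN : (Fintype.card L : ℂ) ≠ 0 := Nat.cast_ne_zero.mpr Fintype.card_ne_zero
  have hH : (stabSum L σ)ᴴ = stabSum L σ := by
    rw [stabSum, Matrix.conjTranspose_sum]
    exact Finset.sum_congr rfl fun v _ => toFun_conjTranspose L σ v.2
  have hfix : ∀ M : MatP P, (∀ v ∈ L, σ.toFun v * M = M) →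
      stabSum L σ * M = (Fintype.card L : ℂ) • M := by
    intro M hM
    rw [stabSum, Finset.sum_mul, Finset.sum_congr rfl fun v _ => hM v.1 v.2, Finset.sum_const, Finset.card_univ,
      Nat.cast_smul_eq_nsmul]
  have hinv : ∀ v ∈ L, σ.toFun v * (U * stabSum L σ) = U * stabSum L σ := by
    intro v hv
    refine Matrix.ext_of_mulVec_single fun i => ?_
    have hmem : stabSum L σ *ᵥ Pi.single i 1 ∈ code L σ := fun w hw => by
      rw [Matrix.mulVec_mulVec, toFun_mul_stabSum L σ hw]
    have := hcode _ hmem v hv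
    simpa only [Matrix.mulVec_mulVec, Matrix.mul_assoc] using this
  have hQ := conj_proj_eq (Q := (Fintype.card L : ℂ)⁻¹ • stabSum L σ) (U := U)
    (by simp [hH])
    (by
      rw [Matrix.smul_mul, Matrix.mul_smul, hfix _ fun v hv => toFun_mul_stabSum L σ hv,
        inv_smul_smul₀ hN])
    hU
    (by rw [Matrix.mul_smul, Matrix.smul_mul, Matrix.mul_smul, hfix _ hinv, inv_smul_smul₀ hN])
  rw [Matrix.mul_smul, Matrix.smul_mul] at hQ
  exact smul_right_injective _ (inv_ne_zero hN) hQ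

/-- Comparing the Pauli coefficients of the code projector, transformed by the component at `p`
of a local automorphism on the one hand, and by the inverses of the other components on the
other. -/
lemma exists_coeff_identity (L : Submodule (ZMod 2) (QV P)) (σ : PauliSection L)
    (u : P → Matrix (Fin 2) (Fin 2) ℂ) (hu : ∀ s, u s ∈ Matrix.unitaryGroup (Fin 2) ℂ)
    (hcode : ∀ ψ ∈ code L σ, locOp u *ᵥ ψ ∈ code L σ) (p : P) :
    ∃ c : QV P → ℂ, (∀ v, c v ≠ 0 ↔ v ∈ L) ∧ ∀ w : QV P,
      ∑ v, c v * ∏ s, conjTr (if s = p then u s else 1) (w s) (v s) =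
        ∑ v, c v * ∏ s, conjTr (if s = p then 1 else (u s)ᴴ) (w s) (v s) := by
  have h1 : ∀ s, (u s)ᴴ * u s = 1 := fun s => Matrix.mem_unitaryGroup_iff'.mp (hu s)
  have h2 : ∀ s, u s * (u s)ᴴ = 1 := fun s => Matrix.mem_unitaryGroup_iff.mp (hu s)
  choose d hd using σ.scalar
  have hd0 : ∀ v, d v ≠ 0 := by
    intro v h0
    have := Matrix.mem_unitaryGroup_iff.mp (σ.unitary v)
    rw [hd v, h0] at this
    simp at this
  refine ⟨fun v => if v ∈ L then d v else 0, fun v => by by_cases h : v ∈ L <;> simp [h, hd0 v],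
    fun w => ?_⟩
  set g : P → Matrix (Fin 2) (Fin 2) ℂ := fun s => if s = p then u s else 1 with hg
  set k : P → Matrix (Fin 2) (Fin 2) ℂ := fun s => if s = p then 1 else (u s)ᴴ with hk
  have hU : (locOp u)ᴴ * locOp u = 1 := by
    rw [locOp_conjTranspose, locOp_mul]; simp only [h1, locOp_one]
  have hgk : locOp g = locOp k * locOp u := by
    rw [locOp_mul]
    congr 1; ext1 s
    by_cases hs : s = p <;> simp [hg, hk, hs, h1]
  have hconj : locOp g * stabSum L σ * (locOp g)ᴴ = locOp k * stabSum L σ * (locOp k)ᴴ := by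
    rw [hgk, Matrix.conjTranspose_mul]
    calc locOp k * locOp u * stabSum L σ * ((locOp u)ᴴ * (locOp k)ᴴ)
        = locOp k * (locOp u * stabSum L σ * (locOp u)ᴴ) * (locOp k)ᴴ := by
          simp only [Matrix.mul_assoc]
      _ = _ := by rw [conj_stabSum L σ hU hcode]
  have hexp : ∀ f : P → Matrix (Fin 2) (Fin 2) ℂ,
      (Wop w * (locOp f * stabSum L σ * (locOp f)ᴴ)).trace =
        ∑ v, (if v ∈ L then d v else 0) * ∏ s, conjTr (f s) (w s) (v s) := by
    intro f
    simp only [← trace_Wop_mul_conj, stabSum, hd, Finset.mul_sum, Finset.sum_mul,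
      Matrix.trace_sum, Matrix.mul_smul, Matrix.smul_mul, Matrix.trace_smul, smul_eq_mul, ite_mul,
      zero_mul]
    rw [← Finset.sum_filter]
    exact (Finset.sum_subtype _ (by simp)
      fun v => d v * (Wop w * (locOp f * Wop v * (locOp f)ᴴ)).trace).symm
  have := congrArg (fun M => (Wop w * M).trace) hconj
  simp only [hexp] at this
  exact this

/-! ### Minimal supports -/

lemma eq_omegaV_smul_add : ∀ a c e : V, a ≠ 0 → c ≠ 0 → a ≠ c →
    e = omegaV e c • a + omegaV e a • c := by
  unfold omegaV
  decide

lemma V_eq_cases : ∀ a b k : V, a ≠ 0 → b ≠ 0 → a ≠ b → k ≠ 0 → k = a ∨ k = b ∨ k = a + b := by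
  decide

lemma omegaV_ne_zero : ∀ a b : V, a ≠ 0 → b ≠ 0 → a ≠ b → omegaV a b ≠ 0 := by
  unfold omegaV
  decide

lemma V_add_ne_zero {a b : V} : a + b ≠ 0 ↔ a ≠ b := by
  revert a b; decide

lemma supp_add_subset {v w : QV P} {S : Set P} (hv : supp v ⊆ S) (hw : supp w ⊆ S) :
    supp (v + w) ⊆ S := by
  intro s hs
  by_contra h
  have h1 : v s = 0 := by_contra fun h' => h (hv h')
  have h2 : w s = 0 := by_contra fun h' => h (hw h')
  exact hs (by simp [h1, h2])

/-- Either the vectors of `L` supported on a suitable `S ∋ p` take a single nonzero value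
at `p`, or a suitable `S ∋ p` with at least three elements carries exactly one vector of full
support with any given nonzero value at `p`, and these differ everywhere on `S`. -/
lemma exists_line_or_frame {L : Submodule (ZMod 2) (QV P)} (hL : Isotropic L)
    (hzero : ¬ HasZeroFactor L) (hbell : ¬ HasBellFactor L) (p : P) :
    (∃ v ∈ L, v p ≠ 0 ∧ ∀ w ∈ L, supp w ⊆ supp v → w p ≠ 0 → w p = v p) ∨
    ∃ (S : Set P) (q r : P), p ∈ S ∧ q ∈ S ∧ r ∈ S ∧ q ≠ p ∧ r ≠ p ∧ q ≠ r ∧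
      (∀ a : V, a ≠ 0 → ∃ v ∈ L, supp v = S ∧ v p = a) ∧
      ∀ v ∈ L, supp v = S → ∀ v' ∈ L, supp v' = S → v ≠ v' → ∀ s ∈ S, v s ≠ v' s := by
  have hne : ∃ v, v ∈ L ∧ v p ≠ 0 := by
    by_contra! h
    exact hzero ⟨{p}, Set.singleton_nonempty p, fun v hv s hs => by rw [hs]; exact h v hv⟩
  obtain ⟨v, ⟨hv, hvp⟩, hmin⟩ : ∃ v, (v ∈ L ∧ v p ≠ 0) ∧
      ∀ w, w ∈ L ∧ w p ≠ 0 → (supp v).ncard ≤ (supp w).ncard := by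
    obtain ⟨v, hv, h⟩ := Set.exists_min_image {v | v ∈ L ∧ v p ≠ 0} (fun v => (supp v).ncard)
      (Set.toFinite _) hne
    exact ⟨v, hv, h⟩
  have hfull : ∀ w ∈ L, w p ≠ 0 → supp w ⊆ supp v → supp w = supp v := fun w hw hwp hs =>
    Set.eq_of_subset_of_ncard_le hs (hmin w ⟨hw, hwp⟩)
  by_cases hline : ∀ w ∈ L, supp w ⊆ supp v → w p ≠ 0 → w p = v p
  · exact Or.inl ⟨v, hv, hvp, hline⟩
  right
  push Not at hline
  obtain ⟨w, hw, hws, hwp, hwv⟩ := hline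
  replace hws := hfull w hw hwp hws
  have hvw : v + w ∈ L := L.add_mem hv hw
  have hvwp : (v + w) p ≠ 0 := V_add_ne_zero.mpr hwv.symm
  have hvws := hfull _ hvw hvwp (supp_add_subset le_rfl hws.le)
  have hdiff : ∀ s ∈ supp v, v s ≠ 0 ∧ w s ≠ 0 ∧ v s ≠ w s := fun s hs =>
    ⟨hs, hws.ge hs, V_add_ne_zero.mp (hvws.ge hs)⟩
  have hoff : ∀ s ∉ supp v, v s = 0 ∧ w s = 0 := fun s hs =>
    ⟨by_contra hs, by_contra fun h => hs (hws.le h)⟩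
  obtain ⟨q, hq, hqp⟩ : ∃ q ∈ supp v, q ≠ p := by
    by_contra! h
    apply omegaV_ne_zero (v p) (w p) hvp hwp hwv.symm
    rw [← hL v hv w hw, omega, Finset.sum_eq_single p _ (by simp)]
    intro s _ hs
    rw [(hoff s fun h' => hs (h s h')).1]
    simp [omegaV]
  obtain ⟨r, hr, hrp, hqr⟩ : ∃ r ∈ supp v, r ≠ p ∧ q ≠ r := by
    by_contra! h
    have hS : supp v = {p, q} := by
      ext s
      constructor
      · intro hs
        by_cases hsp : s = p
        · exact Or.inl hsp
        · exact Or.inr (h s hs hsp).symm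
      · rintro (rfl | rfl)
        · exact hvp
        · exact hq
    have hsum : ∀ x y : QV P, (∀ s ∉ supp v, y s = 0) →
        omega x y = omegaV (x p) (y p) + omegaV (x q) (y q) := by
      intro x y hy
      rw [omega, ← Finset.sum_pair (f := fun s => omegaV (x s) (y s)) hqp.symm]
      refine (Finset.sum_subset (Finset.subset_univ _) fun s _ hs => ?_).symm
      rw [hy s (by simpa [hS] using hs)]
      simp [omegaV]
    refine hbell ⟨p, q, hqp.symm, ?_, v, hv, w, hw, ?_, hS, hws.trans hS, hvws.trans hS⟩
    · intro x hx
      obtain ⟨-, hwq, hvwq⟩ := hdiff q hq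
      have hxv := (hsum x v fun s hs => (hoff s hs).1).symm.trans (hL x hx v hv)
      have hxw := (hsum x w fun s hs => (hoff s hs).2).symm.trans (hL x hx w hw)
      convert L.add_mem (L.smul_mem (omegaV (x p) (w p)) hv) (L.smul_mem (omegaV (x p) (v p)) hw)
      ext1 s
      by_cases hs : s ∈ supp v
      · rw [hS] at hs
        rw [restrTo, if_pos hs]
        obtain rfl | rfl := hs
        · exact eq_omegaV_smul_add _ _ _ hvp hwp hwv.symm
        · rw [CharTwo.add_eq_zero] at hxv hxw
          rw [hxv, hxw]
          exact eq_omegaV_smul_add _ _ _ hq hwq hvwq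
      · rw [restrTo, if_neg (hS ▸ hs)]
        simp [hoff s hs]
    · rintro rfl
      exact hwv rfl
  refine ⟨supp v, q, r, hvp, hq, hr, hqp, hrp, hqr, ?_, ?_⟩
  · intro a ha
    obtain h | h | h := V_eq_cases (v p) (w p) a hvp hwp hwv.symm ha
    · exact ⟨v, hv, rfl, h.symm⟩
    · exact ⟨w, hw, hws, h.symm⟩
    · exact ⟨v + w, hvw, hvws, h.symm⟩
  · intro x hx hxs y hy hys hxy
    have hsub := supp_add_subset hxs.le hys.le
    by_cases hp : x p = y p
    · exfalso
      obtain ⟨s, hs⟩ := Function.ne_iff.mp hxy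
      have hk : (x + y) s ≠ 0 := V_add_ne_zero.mpr hs
      have hkp : (x + y) p = 0 := by
        by_contra h
        exact V_add_ne_zero.mp h hp
      obtain ⟨h1, h2, h3⟩ := hdiff s (hsub hk)
      have hcontr : ∀ z ∈ L, z p ≠ 0 → supp z = supp v → z s ≠ (x + y) s := by
        intro z hz hzp hzs
        have := hfull (z + (x + y)) (L.add_mem hz (L.add_mem hx hy))
          (by rw [Pi.add_apply, hkp, add_zero]; exact hzp) (supp_add_subset hzs.le hsub)
        exact V_add_ne_zero.mp (this.ge (hsub hk))
      obtain h | h | h := V_eq_cases (v s) (w s) _ h1 h2 h3 hk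
      · exact hcontr v hv hvp rfl h.symm
      · exact hcontr w hw hwp hws h.symm
      · exact hcontr (v + w) hvw hvwp hvws h.symm
    · intro s hs
      have := hfull (x + y) (L.add_mem hx hy) (V_add_ne_zero.mpr hp) hsub
      exact V_add_ne_zero.mp (this.ge hs)

/-! ### Vanishing of matrix entries of local automorphisms -/

lemma conjTr_eq_zero_of_line {L : Submodule (ZMod 2) (QV P)} {c : QV P → ℂ}
    (hc : ∀ v, c v ≠ 0 ↔ v ∈ L) (u : P → Matrix (Fin 2) (Fin 2) ℂ)
    (hu : ∀ s, u s ∈ Matrix.unitaryGroup (Fin 2) ℂ) {p : P}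
    (hid : ∀ w : QV P, ∑ v, c v * ∏ s, conjTr (if s = p then u s else 1) (w s) (v s) =
        ∑ v, c v * ∏ s, conjTr (if s = p then 1 else (u s)ᴴ) (w s) (v s))
    {v : QV P} (hv : v ∈ L) (hvp : v p ≠ 0)
    (hline : ∀ w ∈ L, supp w ⊆ supp v → w p ≠ 0 → w p = v p)
    {b : V} (hb : b ≠ 0) (hbv : b ≠ v p) : conjTr (u p) b (v p) = 0 := by
  have h1 : ∀ s, (u s)ᴴ * u s = 1 := fun s => Matrix.mem_unitaryGroup_iff'.mp (hu s)
  have h2 : ∀ s, u s * (u s)ᴴ = 1 := fun s => Matrix.mem_unitaryGroup_iff.mp (hu s)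
  have h := hid (Function.update v p b)
  rw [Finset.sum_eq_single v _ (by simp), Finset.sum_eq_zero] at h
  · have hp := (mul_eq_zero.mp h).resolve_left ((hc v).mpr hv)
    obtain ⟨s, -, hs⟩ := Finset.prod_eq_zero_iff.mp hp
    by_cases hsp : s = p
    · subst hsp; simpa using hs
    · simp only [hsp, if_false, ne_eq, not_false_eq_true, Function.update_of_ne] at hs
      exact absurd hs ((conjTr_one_ne_zero_iff _ _).mpr rfl)
  · intro y _
    by_contra hy
    obtain ⟨hyL, hprod⟩ := mul_ne_zero_iff.mp hy
    rw [hc] at hyL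
    rw [Finset.prod_ne_zero_iff] at hprod
    have hyp : b = y p := by
      have := hprod p (Finset.mem_univ p)
      simpa [conjTr_one_ne_zero_iff] using this
    refine hbv (hyp.trans (hline y hyL ?_ (hyp ▸ hb)))
    intro s hs
    by_cases hsp : s = p
    · subst hsp
      exact hvp
    · by_contra hvs
      have hvs' : v s = 0 := by_contra hvs
      refine hprod s (Finset.mem_univ s) ?_
      rw [Function.update_of_ne hsp, hvs', if_neg hsp]
      exact conjTr_zero_left (by simpa using h2 s) hs
  · intro y _ hyv
    by_contra hy
    obtain ⟨hyL, hprod⟩ := mul_ne_zero_iff.mp hy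
    rw [hc] at hyL
    rw [Finset.prod_ne_zero_iff] at hprod
    have hoff : ∀ s, s ≠ p → v s = y s := by
      intro s hs
      have := hprod s (Finset.mem_univ s)
      simpa [hs, conjTr_one_ne_zero_iff] using this
    have hyp : y p ≠ 0 := by
      intro h0
      refine hprod p (Finset.mem_univ p) ?_
      rw [h0, if_pos rfl, Function.update_self]
      exact conjTr_zero_right (h2 p) hb
    have hsub : supp y ⊆ supp v := by
      intro s hs
      by_cases hsp : s = p
      · subst hsp; exact hvp
      · exact fun h0 => hs ((hoff s hsp).symm.trans h0)
    refine hyv (funext fun s => ?_)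
    by_cases hsp : s = p
    · subst hsp; exact hline y hyL hsub hyp
    · exact (hoff s hsp).symm

lemma conjTr_eq_zero_or_of_frame {L : Submodule (ZMod 2) (QV P)} {c : QV P → ℂ}
    (hc : ∀ v, c v ≠ 0 ↔ v ∈ L) (u : P → Matrix (Fin 2) (Fin 2) ℂ)
    (hu : ∀ s, u s ∈ Matrix.unitaryGroup (Fin 2) ℂ) {p : P}
    (hid : ∀ w : QV P, ∑ v, c v * ∏ s, conjTr (if s = p then u s else 1) (w s) (v s) =
        ∑ v, c v * ∏ s, conjTr (if s = p then 1 else (u s)ᴴ) (w s) (v s))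
    {S : Set P} {q r : P} (hpS : p ∈ S) (hqS : q ∈ S) (hrS : r ∈ S) (hqp : q ≠ p) (hrp : r ≠ p)
    (hqr : q ≠ r) (hex : ∀ a : V, a ≠ 0 → ∃ v ∈ L, supp v = S ∧ v p = a)
    (hdist : ∀ v ∈ L, supp v = S → ∀ v' ∈ L, supp v' = S → v ≠ v' → ∀ s ∈ S, v s ≠ v' s)
    {a b b' : V} (ha : a ≠ 0) (hb : b ≠ 0) (hb' : b' ≠ 0) (hbb' : b ≠ b') :
    conjTr (u p) a b = 0 ∨ conjTr (u p) a b' = 0 := by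
  have h1 : ∀ s, (u s)ᴴ * u s = 1 := fun s => Matrix.mem_unitaryGroup_iff'.mp (hu s)
  have h2 : ∀ s, u s * (u s)ᴴ = 1 := fun s => Matrix.mem_unitaryGroup_iff.mp (hu s)
  by_contra! hcon
  obtain ⟨x, hxL, hxS, hxp⟩ := hex a ha
  obtain ⟨y, hyL, hyS, hyp⟩ := hex b hb
  obtain ⟨z, hzL, hzS, hzp⟩ := hex b' hb'
  have hyz : y ≠ z := by
    rintro rfl
    exact hbb' (hyp.symm.trans hzp)
  have hsuppS : ∀ w w' : QV P, supp w' = S → w p ≠ 0 → (∀ s, s ≠ p → w' s = w s) →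
      supp w = S := by
    intro w w' hw' hwp hoff
    rw [← hw']
    ext s
    by_cases hsp : s = p
    · subst hsp
      exact iff_of_true hwp (hw' ▸ hpS)
    · simp [supp, hoff s hsp]
  have hright : ∀ w : QV P, supp w = S → w p = a →
      ∑ v, c v * ∏ s, conjTr (if s = p then 1 else (u s)ᴴ) (w s) (v s) =
        c x * ∏ s, conjTr (if s = p then 1 else (u s)ᴴ) (w s) (x s) := by
    intro w hw hwp
    refine Finset.sum_eq_single x (fun v _ hvx => ?_) (by simp)
    by_contra hne
    obtain ⟨hvL, hprod⟩ := mul_ne_zero_iff.mp hne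
    rw [hc] at hvL
    rw [Finset.prod_ne_zero_iff] at hprod
    have hvp : a = v p := by
      have := hprod p (Finset.mem_univ p)
      simpa [conjTr_one_ne_zero_iff, hwp] using this
    have hvS : supp v = S := by
      rw [← hw]
      ext s
      by_cases hsp : s = p
      · subst hsp
        simp [supp, hwp, ← hvp]
      · have hs := hprod s (Finset.mem_univ s)
        rw [if_neg hsp] at hs
        constructor
        · intro hvs hws
          rw [hws] at hs
          exact hs (conjTr_zero_left (by simpa using h2 s) hvs)
        · intro hws hvs
          rw [hvs] at hs
          exact hs (conjTr_zero_right (by simpa using h1 s) hws)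
    exact hdist v hvL hvS x hxL hxS hvx p hpS (hvp.symm.trans hxp.symm)
  have hleft : ∀ w : QV P, supp w = S → w p = a → ∀ v : QV P,
      c v * ∏ s, conjTr (if s = p then u s else 1) (w s) (v s) ≠ 0 →
      v ∈ L ∧ supp v = S ∧ ∀ s, s ≠ p → w s = v s := by
    intro w hw hwp v hne
    obtain ⟨hvL, hprod⟩ := mul_ne_zero_iff.mp hne
    rw [hc] at hvL
    rw [Finset.prod_ne_zero_iff] at hprod
    have hoff : ∀ s, s ≠ p → w s = v s := by
      intro s hs
      have := hprod s (Finset.mem_univ s)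
      simpa [hs, conjTr_one_ne_zero_iff] using this
    refine ⟨hvL, hsuppS v w hw (fun h0 => ?_) hoff, hoff⟩
    refine hprod p (Finset.mem_univ p) ?_
    rw [h0, if_pos rfl, hwp]
    exact conjTr_zero_right (h2 p) ha
  have hfactor : ∀ t ∈ L, supp t = S → conjTr (u p) a (t p) ≠ 0 →
      ∀ s, s ≠ p → conjTr (u s)ᴴ (t s) (x s) ≠ 0 := by
    intro t htL htS ht s hsp
    have hwS : supp (Function.update t p a) = S :=
      hsuppS _ t htS (by simpa using ha) fun s hs => by simp [hs]
    have h := hid (Function.update t p a)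
    rw [hright _ hwS (by simp), Finset.sum_eq_single t _ (by simp)] at h
    · have hne : c t * ∏ s, conjTr (if s = p then u s else 1) (Function.update t p a s) (t s) ≠
          0 := by
        refine mul_ne_zero ((hc t).mpr htL) (Finset.prod_ne_zero_iff.mpr fun s _ => ?_)
        by_cases hs : s = p
        · subst hs; simpa using ht
        · simp [hs, conjTr_one_ne_zero_iff]
      rw [h] at hne
      have := Finset.prod_ne_zero_iff.mp (mul_ne_zero_iff.mp hne).2 s (Finset.mem_univ s)
      simpa [hsp] using this
    · intro v _ hvt
      by_contra hne
      obtain ⟨hvL, hvS, hoff⟩ := hleft _ hwS (by simp) v hne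
      have hq := hoff q hqp
      rw [Function.update_of_ne hqp] at hq
      exact hdist v hvL hvS t htL htS hvt q hqS hq.symm
  have hy := hfactor y hyL hyS (hyp ▸ hcon.1)
  have hz := hfactor z hzL hzS (hzp ▸ hcon.2)
  set w : QV P := Function.update (Function.update y r (z r)) p a with hw
  have hwp : w p = a := by simp [hw]
  have hwr : w r = z r := by simp [hw, hrp]
  have hws : ∀ s, s ≠ p → s ≠ r → w s = y s := fun s h h' => by simp [hw, h, h']
  have hwS : supp w = S := by
    ext s
    by_cases hsp : s = p
    · subst hsp
      exact iff_of_true (by simpa [supp, hwp] using ha) hpS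
    · by_cases hsr : s = r
      · subst hsr
        exact iff_of_true (by rw [supp, Set.mem_ofPred_eq, hwr]; exact hzS.ge hrS) hrS
      · rw [← hyS]
        simp [supp, hws s hsp hsr]
  have h := hid w
  rw [hright w hwS hwp] at h
  have hne : c x * ∏ s, conjTr (if s = p then 1 else (u s)ᴴ) (w s) (x s) ≠ 0 := by
    refine mul_ne_zero ((hc x).mpr hxL) (Finset.prod_ne_zero_iff.mpr fun s _ => ?_)
    by_cases hsp : s = p
    · subst hsp
      simp [conjTr_one_ne_zero_iff, hwp, hxp]
    · rw [if_neg hsp]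
      by_cases hsr : s = r
      · subst hsr; rw [hwr]; exact hz s hsp
      · rw [hws s hsp hsr]; exact hy s hsp
  rw [← h] at hne
  obtain ⟨v, -, hv⟩ := Finset.exists_ne_zero_of_sum_ne_zero hne
  obtain ⟨hvL, hvS, hoff⟩ := hleft w hwS hwp v hv
  have hvy : v = y := by
    by_contra hvy
    exact hdist v hvL hvS y hyL hyS hvy q hqS ((hoff q hqp).symm.trans (hws q hqp hqr))
  have hvz : v = z := by
    by_contra hvz
    exact hdist v hvL hvS z hzL hzS hvz r hrS ((hoff r hrp).symm.trans hwr)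
  exact hyz (hvy.symm.trans hvz)

/-- **Theorem (pointwise groups).** Let `L ⊆ V^P` be an isotropic subspace that does
not split off any zero factor nor a Bell Lagrangian. Then for each `p ∈ P` the group
`A(L)_p` is contained in the octahedral group or in one of the infinite dihedral groups
`D_x`, `D_y`, `D_z`. -/
theorem pointwise_groups {P : Type} [Fintype P] [DecidableEq P]
    (L : Submodule (ZMod 2) (QV P)) (hL : Isotropic L)
    (hzero : ¬ HasZeroFactor L) (hbell : ¬ HasBellFactor L)
    (σ : PauliSection L) (p : P) :
    autSetAt L σ p ⊆ octahedral ∨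
    autSetAt L σ p ⊆ Dx ∨ autSetAt L σ p ⊆ Dy ∨ autSetAt L σ p ⊆ Dz := by
  obtain ⟨v, hv, hvp, hline⟩ | ⟨S, q, r, hpS, hqS, hrS, hqp, hrp, hqr, hex, hdist⟩ :=
    exists_line_or_frame hL hzero hbell p
  · have key : ∀ u : P → Matrix (Fin 2) (Fin 2) ℂ,
        (∀ s, u s ∈ Matrix.unitaryGroup (Fin 2) ℂ) →
        (∀ ψ ∈ code L σ, locOp u *ᵥ ψ ∈ code L σ) →
        ∀ b : V, b ≠ 0 → b ≠ v p → conjTr (u p) b (v p) = 0 := by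
      intro u hu hcode b hb hbv
      obtain ⟨c, hc, hid⟩ := exists_coeff_identity L σ u hu hcode p
      exact conjTr_eq_zero_of_line hc u hu hid hv hvp hline hb hbv
    right
    obtain h | h | h := V_cases hvp
    · left
      rintro _ ⟨g, ⟨u, hu, hg, hcode⟩, rfl⟩
      have k := key u hu hcode
      rw [h] at k
      have hz := fun i => adjRot_eq_zero (u p) i 0
      simp only [← hg]
      exact mem_Dx (adjRot_mem_SO3 (hu p)) (hz 1 (k _ (by decide) (by decide)))
        (hz 2 (k _ (by decide) (by decide)))
    · right; left
      rintro _ ⟨g, ⟨u, hu, hg, hcode⟩, rfl⟩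
      have k := key u hu hcode
      rw [h] at k
      have hz := fun i => adjRot_eq_zero (u p) i 1
      simp only [← hg]
      exact mem_Dy (adjRot_mem_SO3 (hu p)) (hz 0 (k _ (by decide) (by decide)))
        (hz 2 (k _ (by decide) (by decide)))
    · right; right
      rintro _ ⟨g, ⟨u, hu, hg, hcode⟩, rfl⟩
      have k := key u hu hcode
      rw [h] at k
      have hz := fun i => adjRot_eq_zero (u p) i 2
      simp only [← hg]
      exact mem_Dz (adjRot_mem_SO3 (hu p)) (hz 0 (k _ (by decide) (by decide)))
        (hz 1 (k _ (by decide) (by decide)))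
  · left
    rintro _ ⟨g, ⟨u, hu, hg, hcode⟩, rfl⟩
    obtain ⟨c, hc, hid⟩ := exists_coeff_identity L σ u hu hcode p
    simp only [← hg]
    refine mem_octahedral (adjRot_mem_SO3 (hu p)) fun i j j' hj => ?_
    refine (conjTr_eq_zero_or_of_frame hc u hu hid hpS hqS hrS hqp hrp hqr hex hdist
      (axisVec_ne_zero i) (axisVec_ne_zero j) (axisVec_ne_zero j')
      (axisVec_injective.ne hj)).imp (adjRot_eq_zero _ _ _) (adjRot_eq_zero _ _ _)

end Stab
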